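/- Let (R,m) be a noetherian local ring and M a nonzero finitely generated R-module of grade g. Suppose there exist integers 0 ≤ m, n < g with (Ω^m_R M)* ≅ Ω^n_R M. Then m, n ≥ 2, g = pd_R M = m + n − 1, and the minimal free resolution of M is self-dual. -/

import Mathlib

open CategoryTheory IsLocalRing

noncomputable def ExtMod (R : Type) [CommRing R] (M N : Type) [AddCommGroup M] [Module R M]
    [AddCommGroup N] [Module R N] (i : ℕ) : ModuleCat R :=
  ((Ext R (ModuleCat.{0} R) i).obj (Opposite.op (ModuleCat.of R M))).obj (ModuleCat.of R N)

noncomputable def mgrade (R : Type) [CommRing R] (M : Type) [AddCommGroup M] [Module R M] : ℕ :=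
  sInf {i | Nontrivial (ExtMod R M R i)}

def IsTotallySelfDual (R : Type) [CommRing R] (M : Type) [AddCommGroup M] [Module R M] : Prop :=
  Nontrivial M ∧ Nonempty (ExtMod R M R (mgrade R M) ≃ₗ[R] M) ∧
    ∀ i, i ≠ mgrade R M → Subsingleton (ExtMod R M R i)

/-- A minimal free resolution of `M` over a local ring `R`: a resolution by finite free
modules all of whose differentials (and the augmentation) have image inside `𝔪`-times
the target (resp. have kernel inside `𝔪 F₀`). -/
structure MinFreeRes (R : Type) [CommRing R] [IsLocalRing R]
    (M : Type) [AddCommGroup M] [Module R M] where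
  F : ℕ → ModuleCat.{0} R
  free : ∀ n, Module.Free R (F n)
  fin : ∀ n, Module.Finite R (F n)
  d : ∀ n, F (n + 1) →ₗ[R] F n
  aug : F 0 →ₗ[R] M
  aug_surj : Function.Surjective aug
  exact_aug : LinearMap.ker aug = LinearMap.range (d 0)
  exact : ∀ n, LinearMap.ker (d n) = LinearMap.range (d (n + 1))
  minimal : ∀ n, LinearMap.range (d n) ≤ (maximalIdeal R) • (⊤ : Submodule R (F n))

namespace MinFreeRes

variable {R : Type} [CommRing R] [IsLocalRing R]
  {M : Type} [AddCommGroup M] [Module R M]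

/-- The `n`-th syzygy of `M` with respect to a minimal free resolution:
`Ω⁰ M = M` and `Ωⁿ⁺¹ M = Im(dₙ) = Ker(dₙ₋₁)`. -/
noncomputable def Syz (C : MinFreeRes R M) : ℕ → ModuleCat.{0} R
  | 0 => ModuleCat.of R M
  | n + 1 => ModuleCat.of R (LinearMap.range (C.d n))

/-- A minimal free resolution is self-dual if it is bounded, of length `r`, and is
isomorphic (as a complex) to its `R`-dual complex with reversed indexing. -/
def SelfDual (C : MinFreeRes R M) : Prop :=
  ∃ r : ℕ, (∀ n, r < n → Subsingleton (C.F n)) ∧ Nontrivial (C.F r) ∧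
    ∃ e : ∀ ⦃m n : ℕ⦄, m + n = r → (C.F n ≃ₗ[R] Module.Dual R (C.F m)),
      ∀ (q n : ℕ) (hp : (q + 1) + n = r) (hq : q + (n + 1) = r),
        (e hp).toLinearMap ∘ₗ C.d n = (C.d q).dualMap ∘ₗ (e hq).toLinearMap

/-- A minimal free resolution is eventually periodic with period `a` if
`Ωⁿ M ≅ Ωⁿ⁺ᵃ M` for some `n`. -/
def EventuallyPeriodic (C : MinFreeRes R M) (a : ℕ) : Prop :=
  0 < a ∧ ∃ n : ℕ, Nonempty (C.Syz n ≃ₗ[R] C.Syz (n + a))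

end MinFreeRes

/-- Stable isomorphism: `X ⊕ P ≅ Y ⊕ Q` for some finite free `P`, `Q`. -/
def StablyIso (R : Type) [CommRing R] (X Y : Type) [AddCommGroup X] [Module R X]
    [AddCommGroup Y] [Module R Y] : Prop :=
  ∃ (P Q : ModuleCat.{0} R), Module.Free R P ∧ Module.Finite R P ∧
    Module.Free R Q ∧ Module.Finite R Q ∧ Nonempty ((X × P) ≃ₗ[R] (Y × Q))


namespace MinFreeRes

variable {R : Type} [CommRing R] [IsLocalRing R]
  {M : Type} [AddCommGroup M] [Module R M]

attribute [instance] MinFreeRes.free MinFreeRes.fin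

/-- The differential `F i → F j`, extended by zero to all pairs with `i ≠ j + 1`. -/
noncomputable def dd (C : MinFreeRes R M) (i j : ℕ) : C.F i →ₗ[R] C.F j :=
  if h : i = j + 1 then h ▸ C.d j else 0

lemma dd_succ (C : MinFreeRes R M) (j : ℕ) : C.dd (j + 1) j = C.d j := by
  simp [dd]

lemma dd_zero_zero (C : MinFreeRes R M) : C.dd 0 0 = 0 := by
  simp [dd]

/-- Exactness of the dual complex of a resolution in degree `i`. -/
def DualExactAt (C : MinFreeRes R M) (i : ℕ) : Prop :=
  LinearMap.ker (C.d i).dualMap = LinearMap.range (C.dd i (i - 1)).dualMap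

lemma d_comp_d (C : MinFreeRes R M) (n : ℕ) : C.d n ∘ₗ C.d (n + 1) = 0 :=
  LinearMap.range_le_ker_iff.mp (C.exact n).ge

lemma dd_comp_d (C : MinFreeRes R M) (i : ℕ) : C.dd i (i - 1) ∘ₗ C.d i = 0 := by
  cases i with
  | zero => exact (congrArg (· ∘ₗ C.d 0) C.dd_zero_zero).trans (LinearMap.zero_comp _)
  | succ i => exact (congrArg (· ∘ₗ C.d (i + 1)) (C.dd_succ i)).trans (C.d_comp_d i)

/-- The chain complex underlying a resolution. -/
noncomputable def toChainComplex (C : MinFreeRes R M) : ChainComplex (ModuleCat.{0} R) ℕ :=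
  ChainComplex.of C.F (fun n => ModuleCat.ofHom (C.d n)) fun n => by
    rw [← ModuleCat.ofHom_comp, C.d_comp_d]; rfl

lemma toChainComplex_d (C : MinFreeRes R M) (n : ℕ) :
    C.toChainComplex.d (n + 1) n = ModuleCat.ofHom (C.d n) :=
  by simp [toChainComplex]

lemma toChainComplex_exactAt_succ (C : MinFreeRes R M) (n : ℕ) :
    C.toChainComplex.ExactAt (n + 1) := by
  rw [HomologicalComplex.exactAt_iff' _ (n + 1 + 1) (n + 1) n (by simp) (by simp),
    ShortComplex.moduleCat_exact_iff_range_eq_ker]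
  simp only [HomologicalComplex.sc', HomologicalComplex.shortComplexFunctor', toChainComplex_d]
  exact (C.exact n).symm

/-- The augmentation, as a morphism out of the degree zero term of the chain complex. -/
noncomputable def augHom (C : MinFreeRes R M) : C.toChainComplex.X 0 ⟶ ModuleCat.of R M :=
  ModuleCat.ofHom C.aug

/-- A minimal free resolution as a projective resolution in the category of modules. -/
noncomputable def toProjectiveResolution (C : MinFreeRes R M) :
    ProjectiveResolution (ModuleCat.of R M) where
  complex := C.toChainComplex
  projective n := by
    change Projective (C.F n)
    exact (IsProjective.iff_projective (C.F n)).mp inferInstance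
  π := (ChainComplex.toSingle₀Equiv _ _).symm ⟨C.augHom, by
    rw [toChainComplex_d]
    refine ModuleCat.hom_ext ?_
    exact LinearMap.range_le_ker_iff.mp C.exact_aug.ge⟩
  quasiIso := ⟨fun n => by
    cases n
    · rw [ChainComplex.quasiIsoAt₀_iff, ShortComplex.quasiIso_iff_of_zeros']
      · constructor
        · rw [ShortComplex.moduleCat_exact_iff_range_eq_ker]
          change LinearMap.range (C.toChainComplex.d 1 0).hom = LinearMap.ker (ModuleCat.Hom.hom
            (((C.toChainComplex.toSingle₀Equiv (ModuleCat.of R M)).symm ⟨C.augHom, _⟩).f 0))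
          rw [ChainComplex.toSingle₀Equiv_symm_apply_f_zero, toChainComplex_d]
          exact C.exact_aug.symm
        · change Epi (((C.toChainComplex.toSingle₀Equiv (ModuleCat.of R M)).symm
            ⟨C.augHom, _⟩).f 0)
          rw [ChainComplex.toSingle₀Equiv_symm_apply_f_zero]
          exact (ModuleCat.epi_iff_surjective _).mpr C.aug_surj
      all_goals rfl
    · rw [quasiIsoAt_iff_exactAt']
      · apply toChainComplex_exactAt_succ
      · apply ChainComplex.exactAt_succ_single_obj⟩

lemma toChainComplex_d_eq (C : MinFreeRes R M) (i j : ℕ) :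
    C.toChainComplex.d i j = ModuleCat.ofHom (C.dd i j) := by
  by_cases h : i = j + 1
  · subst h
    rw [toChainComplex_d, dd_succ]
  · rw [C.toChainComplex.shape _ _ fun h' => h h'.symm, dd, dif_neg h, ModuleCat.ofHom_zero]
    rfl

lemma subsingleton_extMod_iff (C : MinFreeRes R M) (i : ℕ) :
    Subsingleton (ExtMod R M R i) ↔ C.DualExactAt i := by
  rw [← ModuleCat.isZero_iff_subsingleton, ExtMod,
    (C.toProjectiveResolution.isoExt i (ModuleCat.of R R)).isZero_iff,
    ← HomologicalComplex.exactAt_iff_isZero_homology,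
    HomologicalComplex.exactAt_iff' _ (i - 1) i (i + 1) (by cases i <;> simp) (by simp),
    ShortComplex.moduleCat_exact_iff]
  change (∀ φ : C.F i ⟶ ModuleCat.of R R, C.toChainComplex.d (i + 1) i ≫ φ = 0 →
    ∃ ψ : C.F (i - 1) ⟶ ModuleCat.of R R, C.toChainComplex.d i (i - 1) ≫ ψ = φ) ↔ _
  rw [toChainComplex_d, toChainComplex_d_eq]
  have hle : LinearMap.range (C.dd i (i - 1)).dualMap ≤ LinearMap.ker (C.d i).dualMap := by
    rw [LinearMap.range_le_ker_iff, LinearMap.dualMap_comp_dualMap, dd_comp_d]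
    exact LinearMap.ext fun φ => φ.comp_zero
  constructor
  · intro h
    refine le_antisymm (fun φ hφ => ?_) hle
    obtain ⟨ψ, hψ⟩ := h (ModuleCat.ofHom φ) (ModuleCat.hom_ext hφ)
    exact ⟨ψ.hom, congrArg ModuleCat.Hom.hom hψ⟩
  · intro h φ hφ
    have hmem : φ.hom ∈ LinearMap.ker (C.d i).dualMap := congrArg ModuleCat.Hom.hom hφ
    rw [h] at hmem
    obtain ⟨ψ, hψ⟩ := hmem
    exact ⟨ModuleCat.ofHom ψ, ModuleCat.hom_ext hψ⟩

end MinFreeRes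

lemma LinearMap.range_dualMap_le_smul_top {R P Q : Type} [CommRing R]
    [AddCommGroup P] [Module R P] [Module.Free R P] [Module.Finite R P]
    [AddCommGroup Q] [Module R Q] (f : P →ₗ[R] Q) (I : Ideal R)
    (hf : LinearMap.range f ≤ I • (⊤ : Submodule R Q)) :
    LinearMap.range f.dualMap ≤ I • (⊤ : Submodule R (Module.Dual R P)) := by
  rintro _ ⟨φ, rfl⟩
  let b := Module.Free.chooseBasis R P
  rw [← b.sum_dual_apply_smul_coord (f.dualMap φ)]
  refine Submodule.sum_mem _ fun i _ => Submodule.smul_mem_smul ?_ trivial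
  have : φ (f (b i)) ∈ (I • (⊤ : Submodule R Q)).map φ :=
    Submodule.mem_map_of_mem (hf ⟨b i, rfl⟩)
  rw [Submodule.map_smul''] at this
  exact Submodule.smul_le.mpr (fun r hr s _ => I.mul_mem_right s hr) this

section ProjectiveCover

variable {R : Type} [CommRing R] [IsLocalRing R]

lemma LinearMap.surjective_of_comp_surjective_of_ker_le {P Q X : Type}
    [AddCommGroup P] [Module R P] [AddCommGroup Q] [Module R Q] [Module.Finite R Q]
    [AddCommGroup X] [Module R X] (a : P →ₗ[R] Q) (q : Q →ₗ[R] X)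
    (hq : LinearMap.ker q ≤ maximalIdeal R • (⊤ : Submodule R Q))
    (h : Function.Surjective (q ∘ₗ a)) : Function.Surjective a := by
  rw [← LinearMap.range_eq_top, eq_top_iff]
  refine Submodule.le_of_le_smul_of_le_jacobson_bot (I := maximalIdeal R) Module.Finite.fg_top
    (maximalIdeal_le_jacobson _) fun y _ => ?_
  obtain ⟨x, hx⟩ := h (q y)
  rw [← add_sub_cancel (a x) y]
  refine Submodule.add_mem_sup ⟨x, rfl⟩ (hq ?_)
  rw [LinearMap.mem_ker, map_sub, sub_eq_zero, ← hx, LinearMap.comp_apply]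

/-- Uniqueness of projective covers over a local ring. -/
lemma exists_linearEquiv_of_projectiveCover {P Q X : Type}
    [AddCommGroup P] [Module R P] [Module.Free R P] [Module.Finite R P]
    [AddCommGroup Q] [Module R Q] [Module.Free R Q] [Module.Finite R Q]
    [AddCommGroup X] [Module R X] (p : P →ₗ[R] X) (q : Q →ₗ[R] X)
    (hp : Function.Surjective p) (hq : Function.Surjective q)
    (hp' : LinearMap.ker p ≤ maximalIdeal R • (⊤ : Submodule R P))
    (hq' : LinearMap.ker q ≤ maximalIdeal R • (⊤ : Submodule R Q)) :
    ∃ g : P ≃ₗ[R] Q, q ∘ₗ g.toLinearMap = p := by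
  obtain ⟨a, ha⟩ := Module.projective_lifting_property q p hq
  obtain ⟨b, hb⟩ := Module.projective_lifting_property p q hp
  have has := a.surjective_of_comp_surjective_of_ker_le q hq' (ha ▸ hp)
  have hbs := b.surjective_of_comp_surjective_of_ker_le p hp' (hb ▸ hq)
  have hinj : Function.Injective (b ∘ₗ a) :=
    OrzechProperty.injective_of_surjective_endomorphism _ (hbs.comp has)
  exact ⟨LinearEquiv.ofBijective a ⟨Function.Injective.of_comp hinj, has⟩, ha⟩

/-- One step in the comparison of two minimal resolutions. -/
lemma exists_linearEquiv_comm {P Q A B : Type}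
    [AddCommGroup P] [Module R P] [Module.Free R P] [Module.Finite R P]
    [AddCommGroup Q] [Module R Q] [Module.Free R Q] [Module.Finite R Q]
    [AddCommGroup A] [Module R A] [AddCommGroup B] [Module R B]
    (p : P →ₗ[R] A) (q : Q →ₗ[R] B) (f : A →ₗ[R] B) (hf : Function.Injective f)
    (hfr : (LinearMap.range p).map f = LinearMap.range q)
    (hp : LinearMap.ker p ≤ maximalIdeal R • (⊤ : Submodule R P))
    (hq : LinearMap.ker q ≤ maximalIdeal R • (⊤ : Submodule R Q)) :
    ∃ g : P ≃ₗ[R] Q, f ∘ₗ p = q ∘ₗ g.toLinearMap ∧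
      (LinearMap.ker p).map g.toLinearMap = LinearMap.ker q := by
  have hmem : ∀ x, (f ∘ₗ p) x ∈ LinearMap.range q := fun x =>
    hfr ▸ Submodule.mem_map_of_mem ⟨x, rfl⟩
  obtain ⟨g, hg⟩ := exists_linearEquiv_of_projectiveCover
    ((f ∘ₗ p).codRestrict (LinearMap.range q) hmem) q.rangeRestrict
    (by
      rintro ⟨y, hy⟩
      rw [← hfr] at hy
      obtain ⟨_, ⟨x, rfl⟩, hx⟩ := hy
      exact ⟨x, Subtype.ext hx⟩)
    q.surjective_rangeRestrict
    (by rwa [LinearMap.ker_codRestrict, LinearMap.ker_comp_of_ker_eq_bot _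
      (LinearMap.ker_eq_bot.mpr hf)])
    (by rwa [LinearMap.ker_rangeRestrict])
  have hg' : ∀ x, q (g x) = f (p x) := fun x => congrArg Subtype.val (LinearMap.congr_fun hg x)
  refine ⟨g, LinearMap.ext fun x => (hg' x).symm, le_antisymm ?_ fun y hy => ?_⟩
  · rintro _ ⟨x, hx, rfl⟩
    rw [SetLike.mem_coe, LinearMap.mem_ker] at hx
    rw [LinearMap.mem_ker, LinearEquiv.coe_coe, hg', hx, map_zero]
  · refine ⟨g.symm y, hf ?_, g.apply_symm_apply y⟩
    rw [← hg', g.apply_symm_apply, map_zero]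
    exact hy

/-- Comparison of two complexes of free modules that are exact and minimal up to degree `N`. -/
lemma exists_chain_equiv (N : ℕ) (A B : ℕ → Type)
    [∀ n, AddCommGroup (A n)] [∀ n, Module R (A n)]
    [∀ n, Module.Free R (A n)] [∀ n, Module.Finite R (A n)]
    [∀ n, AddCommGroup (B n)] [∀ n, Module R (B n)]
    [∀ n, Module.Free R (B n)] [∀ n, Module.Finite R (B n)]
    (dA : ∀ n, A (n + 1) →ₗ[R] A n) (dB : ∀ n, B (n + 1) →ₗ[R] B n)
    (hA : ∀ n < N, LinearMap.ker (dA n) = LinearMap.range (dA (n + 1)))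
    (hB : ∀ n < N, LinearMap.ker (dB n) = LinearMap.range (dB (n + 1)))
    (hA' : ∀ n < N, LinearMap.ker (dA n) ≤ maximalIdeal R • (⊤ : Submodule R (A (n + 1))))
    (hB' : ∀ n < N, LinearMap.ker (dB n) ≤ maximalIdeal R • (⊤ : Submodule R (B (n + 1))))
    (f₀ : A 0 ≃ₗ[R] B 0)
    (hf₀ : (LinearMap.range (dA 0)).map f₀.toLinearMap = LinearMap.range (dB 0)) :
    ∃ f : ∀ n, A n →ₗ[R] B n,
      (∀ n ≤ N, Function.Bijective (f n) ∧
        (LinearMap.range (dA n)).map (f n) = LinearMap.range (dB n)) ∧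
      ∀ n < N, f n ∘ₗ dA n = dB n ∘ₗ f (n + 1) := by
  have key : ∀ (n : ℕ) (f : A n →ₗ[R] B n), ∃ g : A (n + 1) →ₗ[R] B (n + 1),
      n < N → (Function.Bijective f ∧ (LinearMap.range (dA n)).map f = LinearMap.range (dB n)) →
      (Function.Bijective g ∧
        (LinearMap.range (dA (n + 1))).map g = LinearMap.range (dB (n + 1))) ∧
      f ∘ₗ dA n = dB n ∘ₗ g := by
    intro n f
    by_cases h : n < N ∧
      (Function.Bijective f ∧ (LinearMap.range (dA n)).map f = LinearMap.range (dB n))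
    · obtain ⟨hn, hf, hfr⟩ := h
      obtain ⟨g, hg, hgk⟩ :=
        exists_linearEquiv_comm (dA n) (dB n) f hf.1 hfr (hA' n hn) (hB' n hn)
      rw [hA n hn, hB n hn] at hgk
      exact ⟨g, fun _ _ => ⟨⟨g.bijective, hgk⟩, hg⟩⟩
    · exact ⟨0, fun h₁ h₂ => absurd ⟨h₁, h₂⟩ h⟩
  choose step hstep using key
  let f : ∀ n, A n →ₗ[R] B n := fun n => Nat.rec f₀.toLinearMap step n
  have hf : ∀ n ≤ N, Function.Bijective (f n) ∧
      (LinearMap.range (dA n)).map (f n) = LinearMap.range (dB n) := by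
    intro n
    induction n with
    | zero => exact fun _ => ⟨f₀.bijective, hf₀⟩
    | succ n ih => exact fun hn => (hstep n (f n) hn (ih (Nat.le_of_succ_le hn))).1
  exact ⟨f, hf, fun n hn => (hstep n (f n) hn (hf n hn.le)).2⟩

end ProjectiveCover

namespace MinFreeRes

variable {R : Type} [CommRing R] [IsLocalRing R]
  {M : Type} [AddCommGroup M] [Module R M]

lemma ker_d_le (C : MinFreeRes R M) (n : ℕ) :
    LinearMap.ker (C.d n) ≤ maximalIdeal R • (⊤ : Submodule R (C.F (n + 1))) :=
  (C.exact n).trans_le (C.minimal (n + 1))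

lemma ker_dualMap_d_le (C : MinFreeRes R M) {i : ℕ} (hi : C.DualExactAt i) :
    LinearMap.ker (C.d i).dualMap ≤
      maximalIdeal R • (⊤ : Submodule R (Module.Dual R (C.F i))) := by
  refine hi.trans_le (LinearMap.range_dualMap_le_smul_top _ _ ?_)
  unfold dd
  split_ifs with h
  · generalize i - 1 = j at h
    subst h
    exact C.minimal j
  · rintro _ ⟨x, rfl⟩
    exact zero_mem _

/-- Transport of duals along an equality of indices. -/
noncomputable def dualCongr (C : MinFreeRes R M) {i j : ℕ} (h : i = j) :
    Module.Dual R (C.F i) ≃ₗ[R] Module.Dual R (C.F j) :=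
  h ▸ LinearEquiv.refl R _

lemma dualCongr_comp_dualMap (C : MinFreeRes R M) {a b q : ℕ} (ha : a = q + 1) (hb : b = q) :
    (C.dualCongr ha).toLinearMap ∘ₗ (C.dd a b).dualMap =
      (C.d q).dualMap ∘ₗ (C.dualCongr hb).toLinearMap := by
  subst ha hb
  rw [dd_succ]
  rfl

/-- A minimal resolution whose initial part matches the end of the dual of `C` is isomorphic
to the dual of `C`, as long as the latter is exact. -/
lemma exists_equiv_dual (C : MinFreeRes R M) (r : ℕ) (hE : ∀ i < r, C.DualExactAt i)
    (A : ℕ → Type) [∀ n, AddCommGroup (A n)] [∀ n, Module R (A n)]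
    [∀ n, Module.Free R (A n)] [∀ n, Module.Finite R (A n)]
    (dA : ∀ n, A (n + 1) →ₗ[R] A n)
    (hA : ∀ n, LinearMap.ker (dA n) = LinearMap.range (dA (n + 1)))
    (hA' : ∀ n, LinearMap.ker (dA n) ≤ maximalIdeal R • (⊤ : Submodule R (A (n + 1))))
    (f₀ : A 0 ≃ₗ[R] Module.Dual R (C.F r))
    (hf₀ : (LinearMap.range (dA 0)).map f₀.toLinearMap =
      LinearMap.range (C.dd r (r - 1)).dualMap) :
    ∃ e : ∀ ⦃k j : ℕ⦄, k + j = r → (A j ≃ₗ[R] Module.Dual R (C.F k)),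
      (∀ (q n : ℕ) (hp : (q + 1) + n = r) (hq : q + (n + 1) = r),
        (e hp).toLinearMap ∘ₗ dA n = (C.d q).dualMap ∘ₗ (e hq).toLinearMap) ∧
      dA r = 0 := by
  have aux : ∀ {a b c : ℕ}, a = b + 1 → c = b - 1 → C.DualExactAt b →
      LinearMap.ker (C.dd a b).dualMap = LinearMap.range (C.dd b c).dualMap ∧
      LinearMap.ker (C.dd a b).dualMap ≤
        maximalIdeal R • (⊤ : Submodule R (Module.Dual R (C.F b))) := by
    rintro a b c rfl rfl hb
    rw [dd_succ]
    exact ⟨hb, C.ker_dualMap_d_le hb⟩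
  obtain ⟨f, hf, hcomm⟩ := exists_chain_equiv r A (fun j => Module.Dual R (C.F (r - j))) dA
    (fun j => (C.dd (r - j) (r - (j + 1))).dualMap) (fun n _ => hA n)
    (fun n hn => (aux (by omega) (by omega) (hE _ (by omega))).1) (fun n _ => hA' n)
    (fun n hn => (aux (c := r - (n + 1) - 1) (by omega) rfl (hE _ (by omega))).2) f₀ hf₀
  refine ⟨fun k j h => (LinearEquiv.ofBijective (f j) (hf j (by omega)).1).trans
    (C.dualCongr (by omega)), fun q n hp hq => ?_, ?_⟩
  · change (C.dualCongr _).toLinearMap ∘ₗ (f n ∘ₗ dA n) = _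
    rw [hcomm n (by omega), ← LinearMap.comp_assoc, C.dualCongr_comp_dualMap _ (by omega)]
    rfl
  · have hz : C.dd (r - r) (r - (r + 1)) = 0 := dif_neg (by omega)
    have h := (hf r le_rfl).2
    rw [hz] at h
    refine LinearMap.ext fun x => (hf r le_rfl).1.1 ?_
    have hx : f r (dA r x) ∈ (LinearMap.range (dA r)).map (f r) :=
      Submodule.mem_map_of_mem ⟨x, rfl⟩
    rw [h] at hx
    obtain ⟨φ, hφ⟩ := hx
    rw [← hφ, LinearMap.zero_apply, map_zero]
    exact φ.comp_zero

lemma subsingleton_of_d_eq_zero (C : MinFreeRes R M) {n : ℕ} (h : C.d n = 0) :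
    Subsingleton (C.F (n + 1)) := by
  have hk := C.ker_d_le n
  rw [h, LinearMap.ker_zero] at hk
  rw [← Submodule.subsingleton_iff R]
  exact subsingleton_of_bot_eq_top (Submodule.eq_bot_of_le_smul_of_le_jacobson_bot
    (maximalIdeal R) ⊤ Module.Finite.fg_top hk (maximalIdeal_le_jacobson _)).symm

lemma subsingleton_of_le (C : MinFreeRes R M) {n i : ℕ} (h : Subsingleton (C.F n)) (hi : n ≤ i) :
    Subsingleton (C.F i) := by
  induction i, hi using Nat.le_induction with
  | base => exact h
  | succ i _ ih => exact C.subsingleton_of_d_eq_zero (LinearMap.ext fun x => Subsingleton.elim _ _)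

lemma dualExactAt_of_subsingleton (C : MinFreeRes R M) {i : ℕ} (h : Subsingleton (C.F i)) :
    C.DualExactAt i := by
  have : Subsingleton (Module.Dual R (C.F i)) :=
    ⟨fun φ ψ => LinearMap.ext fun x => by rw [Subsingleton.elim x 0, map_zero, map_zero]⟩
  exact Subsingleton.elim _ _

lemma subsingleton_dual (C : MinFreeRes R M) (h : C.DualExactAt 0) :
    Subsingleton (Module.Dual R M) := by
  refine subsingleton_of_forall_eq 0 fun φ => ?_
  have hmem : φ ∘ₗ C.aug ∈ LinearMap.ker (C.d 0).dualMap := by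
    rw [LinearMap.mem_ker]
    change φ ∘ₗ (C.aug ∘ₗ C.d 0) = 0
    rw [LinearMap.range_le_ker_iff.mp C.exact_aug.ge, LinearMap.comp_zero]
  rw [h] at hmem
  obtain ⟨ψ, hψ⟩ := hmem
  have hz : C.dd 0 (0 - 1) = 0 := C.dd_zero_zero
  rw [hz] at hψ
  refine LinearMap.ext fun x => ?_
  obtain ⟨y, rfl⟩ := C.aug_surj x
  exact (LinearMap.congr_fun hψ y).symm.trans (map_zero ψ)

/-- An isomorphism `(Ω^(m+1) M)* ≅ Ω^(n+1) M` lifts to projective covers. -/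
lemma exists_equiv_of_syz (C : MinFreeRes R M) (m n : ℕ) (hm : C.DualExactAt m)
    (hm' : C.DualExactAt (m + 1))
    (φ : Module.Dual R (LinearMap.range (C.d m)) ≃ₗ[R] LinearMap.range (C.d n)) :
    ∃ f₀ : C.F (n + 1) ≃ₗ[R] Module.Dual R (C.F m),
      (LinearMap.range (C.d (n + 1))).map f₀.toLinearMap =
        LinearMap.range (C.dd m (m - 1)).dualMap := by
  let ρ : Module.Dual R (C.F m) →ₗ[R] Module.Dual R (LinearMap.range (C.d m)) :=
    (LinearMap.range (C.d m)).subtype.dualMap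
  have hρ : Function.Surjective ρ := by
    intro θ
    have hmem : θ ∘ₗ (C.d m).rangeRestrict ∈ LinearMap.ker (C.d (m + 1)).dualMap := by
      refine LinearMap.ext fun x => ?_
      have : (C.d m).rangeRestrict (C.d (m + 1) x) = 0 :=
        Subtype.ext (LinearMap.congr_fun (C.d_comp_d m) x)
      exact (congrArg θ this).trans (map_zero θ)
    rw [hm'] at hmem
    obtain ⟨ψ, hψ⟩ := hmem
    refine ⟨ψ, LinearMap.ext ?_⟩
    rintro ⟨_, x, rfl⟩
    have := LinearMap.congr_fun hψ x
    change ψ (C.dd (m + 1) m x) = θ _ at this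
    rw [dd_succ] at this
    exact this
  have hker : LinearMap.ker (φ.toLinearMap ∘ₗ ρ) = LinearMap.ker (C.d m).dualMap := by
    rw [LinearEquiv.ker_comp]
    ext ψ
    rw [LinearMap.mem_ker, LinearMap.mem_ker]
    refine ⟨fun h => LinearMap.ext fun x => LinearMap.congr_fun h ⟨_, x, rfl⟩,
      fun h => LinearMap.ext ?_⟩
    rintro ⟨_, x, rfl⟩
    exact LinearMap.congr_fun h x
  obtain ⟨g, -, hg⟩ := exists_linearEquiv_comm (C.d n).rangeRestrict (φ.toLinearMap ∘ₗ ρ)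
    LinearMap.id Function.injective_id
    (by rw [LinearMap.range_rangeRestrict, Submodule.map_id,
      LinearMap.range_comp_of_range_eq_top _ (LinearMap.range_eq_top.mpr hρ), φ.range])
    (by rw [LinearMap.ker_rangeRestrict]; exact C.ker_d_le n)
    (hker.trans_le (C.ker_dualMap_d_le hm))
  rw [hker, LinearMap.ker_rangeRestrict, C.exact n] at hg
  exact ⟨g, hg.trans hm⟩

/-- If part of the resolution is isomorphic to the dual of its initial part, then exactness
of the resolution yields exactness of its dual. -/
lemma dualExactAt_of_equiv (C : MinFreeRes R M) {i j : ℕ}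
    (e₀ : C.F i ≃ₗ[R] Module.Dual R (C.F (j + 2)))
    (e₁ : C.F (i + 1) ≃ₗ[R] Module.Dual R (C.F (j + 1)))
    (e₂ : C.F (i + 2) ≃ₗ[R] Module.Dual R (C.F j))
    (h₀ : e₀.toLinearMap ∘ₗ C.d i = (C.d (j + 1)).dualMap ∘ₗ e₁.toLinearMap)
    (h₁ : e₁.toLinearMap ∘ₗ C.d (i + 1) = (C.d j).dualMap ∘ₗ e₂.toLinearMap) :
    C.DualExactAt (i + 1) := by
  have hdd : C.dd (i + 1) (i + 1 - 1) = C.d i := C.dd_succ i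
  unfold DualExactAt
  rw [hdd]
  refine le_antisymm (fun φ hφ => ?_) ?_
  · obtain ⟨x, hx⟩ := (Module.evalEquiv R (C.F (j + 1))).surjective (φ ∘ₗ e₁.symm.toLinearMap)
    have hx' : ∀ y, e₁ y x = φ y := fun y => by
      have := LinearMap.congr_fun hx (e₁ y)
      simpa using this
    have hxk : C.d j x = 0 := by
      rw [← Module.forall_dual_apply_eq_zero_iff R]
      intro ψ
      obtain ⟨z, rfl⟩ := e₂.surjective ψ
      have h1 := LinearMap.congr_fun (LinearMap.congr_fun h₁ z) x
      have h2 := LinearMap.congr_fun hφ z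
      exact h1.symm.trans ((hx' _).trans h2)
    rw [← LinearMap.mem_ker, C.exact j] at hxk
    obtain ⟨w, rfl⟩ := hxk
    refine ⟨(Module.Dual.eval R _ w) ∘ₗ e₀.toLinearMap, LinearMap.ext fun y => ?_⟩
    rw [← hx' y]
    exact LinearMap.congr_fun (LinearMap.congr_fun h₀ y) w
  · rw [LinearMap.range_le_ker_iff, LinearMap.dualMap_comp_dualMap, C.d_comp_d]
    exact LinearMap.ext fun φ => φ.comp_zero

/-- An isomorphism between the end of the resolution and the dual of its beginning can be
dualized. -/
lemma exists_equiv_of_dual (C : MinFreeRes R M) {i : ℕ}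
    (e : C.F (i + 1) ≃ₗ[R] Module.Dual R (C.F 0)) (e' : C.F i ≃ₗ[R] Module.Dual R (C.F 1))
    (h : e'.toLinearMap ∘ₗ C.d i = (C.d 0).dualMap ∘ₗ e.toLinearMap) :
    ∃ f₀ : C.F 0 ≃ₗ[R] Module.Dual R (C.F (i + 1)),
      (LinearMap.range (C.d 0)).map f₀.toLinearMap =
        LinearMap.range (C.dd (i + 1) (i + 1 - 1)).dualMap := by
  have hdd : C.dd (i + 1) (i + 1 - 1) = C.d i := C.dd_succ i
  let f₀ := (Module.evalEquiv R (C.F 0)).trans e.dualMap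
  let f₁ := (Module.evalEquiv R (C.F 1)).trans e'.dualMap
  have hf : f₀.toLinearMap ∘ₗ C.d 0 = (C.d i).dualMap ∘ₗ f₁.toLinearMap :=
    LinearMap.ext fun x => LinearMap.ext fun y =>
      (LinearMap.congr_fun (LinearMap.congr_fun h y) x).symm
  refine ⟨f₀, ?_⟩
  rw [hdd, ← LinearMap.range_comp, hf, LinearMap.range_comp_of_range_eq_top]
  exact LinearEquiv.range f₁

end MinFreeRes

/-- If `(Ω^m M)* ≅ Ω^n M` for some `0 ≤ m, n < g = grade M`, then `m, n ≥ 2`,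
`g = pd_R M = m + n - 1`, and the minimal free resolution of `M` is self-dual. -/
theorem stmt_15 (R : Type) [CommRing R] [IsLocalRing R] [IsNoetherianRing R]
    (M : Type) [AddCommGroup M] [Module R M] [Module.Finite R M] [Nontrivial M]
    (g : ℕ) (hg : mgrade R M = g) (C : MinFreeRes R M)
    (m n : ℕ) (hm : m < g) (hn : n < g)
    (hiso : Nonempty (Module.Dual R (C.Syz m) ≃ₗ[R] C.Syz n)) :
    2 ≤ m ∧ 2 ≤ n ∧ g = m + n - 1 ∧
      (∀ i, g < i → Subsingleton (C.F i)) ∧ Nontrivial (C.F g) ∧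
      C.SelfDual := by
  obtain ⟨hiso⟩ := hiso
  have hg0 : 0 < g := Nat.zero_lt_of_lt hm
  have hE : ∀ i < g, C.DualExactAt i := fun i hi => by
    rw [← C.subsingleton_extMod_iff]
    rw [← hg, mgrade] at hi
    exact not_nontrivial_iff_subsingleton.mp (Nat.notMem_of_lt_sInf hi)
  have hEg : ¬ C.DualExactAt g := by
    rw [← C.subsingleton_extMod_iff, not_subsingleton_iff_nontrivial, ← hg]
    exact Nat.sInf_mem (Nat.nonempty_of_pos_sInf (hg.symm ▸ hg0))
  have hF : ∀ i ≤ g, Nontrivial (C.F i) := fun i hi => by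
    rw [← not_subsingleton_iff_nontrivial]
    exact fun h => hEg (C.dualExactAt_of_subsingleton (C.subsingleton_of_le h hi))
  have hM := C.subsingleton_dual (hE 0 hg0)
  cases m with
  | zero =>
    change Module.Dual R M ≃ₗ[R] C.Syz n at hiso
    cases n with
    | zero => exact absurd (hiso.symm.toEquiv.subsingleton) (not_subsingleton M)
    | succ n =>
      change Module.Dual R M ≃ₗ[R] LinearMap.range (C.d n) at hiso
      have hs := hiso.symm.toEquiv.subsingleton
      have hd : C.d n = 0 :=
        LinearMap.range_eq_bot.mp ((Submodule.subsingleton_iff_eq_bot).mp hs)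
      exact absurd (C.subsingleton_of_d_eq_zero hd)
        (not_subsingleton_iff_nontrivial.mpr (hF _ hn.le))
  | succ m =>
  change Module.Dual R (LinearMap.range (C.d m)) ≃ₗ[R] C.Syz n at hiso
  cases n with
  | zero =>
    change Module.Dual R (LinearMap.range (C.d m)) ≃ₗ[R] M at hiso
    have h : Subsingleton (Module.Dual R (LinearMap.range (C.d m))) := by
      refine subsingleton_of_forall_eq 0 fun φ => LinearMap.ext fun x => ?_
      have := LinearMap.congr_fun
        (Subsingleton.elim (Module.Dual.eval R _ x ∘ₗ hiso.symm.toLinearMap) 0) (hiso φ)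
      simpa using this
    exact absurd hiso.symm.toEquiv.subsingleton (not_subsingleton M)
  | succ n =>
  change Module.Dual R (LinearMap.range (C.d m)) ≃ₗ[R] LinearMap.range (C.d n) at hiso
  obtain ⟨f₀, hf₀⟩ := C.exists_equiv_of_syz m n (hE m (by omega)) (hE (m + 1) hm) hiso
  obtain ⟨e, he, htop⟩ := C.exists_equiv_dual m (fun i hi => hE i (by omega))
    (fun j => C.F (n + 1 + j)) (fun j => C.d (n + 1 + j)) (fun j => C.exact (n + 1 + j))
    (fun j => C.ker_d_le (n + 1 + j)) f₀ hf₀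
  have hpd : Subsingleton (C.F (n + 1 + m + 1)) := C.subsingleton_of_d_eq_zero htop
  have hle : g ≤ n + 1 + m := by
    by_contra! h
    exact not_subsingleton_iff_nontrivial.mpr (hF _ h) hpd
  have hge : n + 1 + m ≤ g := by
    by_contra! h
    obtain ⟨j, k, rfl, rfl⟩ : ∃ j k, g = n + 1 + j + 1 ∧ m = j + 2 + k :=
      ⟨g - (n + 2), m - (g - (n + 2)) - 2, by omega, by omega⟩
    have h₀ := he (k + 1) j (by omega) (by omega)
    have h₁ := he k (j + 1) (by omega) (by omega)
    exact hEg (C.dualExactAt_of_equiv _ _ _ h₀ h₁)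
  obtain rfl : g = n + 1 + m := le_antisymm hle hge
  obtain ⟨m, rfl⟩ : ∃ k, m = k + 1 := ⟨m - 1, by omega⟩
  obtain ⟨f₁, hf₁⟩ := C.exists_equiv_of_dual _ _ (he 0 m (by omega) (by omega))
  obtain ⟨e', he', -⟩ := C.exists_equiv_dual _ hE (fun j => C.F j) C.d C.exact C.ker_d_le f₁ hf₁
  have hbound : ∀ i, n + 1 + (m + 1) < i → Subsingleton (C.F i) :=
    fun i hi => C.subsingleton_of_le hpd hi
  exact ⟨by omega, by omega, by omega, hbound, hF _ le_rfl,
    n + 1 + (m + 1), hbound, hF _ le_rfl, e', he'⟩
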